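/- Let U be a normal ultrafilter on a measurable cardinal δ. If there exists a singular strong limit cardinal κ with cof(κ) = δ such that κ^δ = κ⁺ (the SCH holds at κ) and there exists a □_κ-sequence, then there exists a limit ordinal λ with cof(λ) = κ⁺ and an unbounded subset of λ that is fresh over Ult(V,U). -/

import Mathlib

noncomputable section

open Cardinal Set

namespace MU

/-- The type of ordinals below the initial ordinal of `δ`, serving as the underlying
set of the cardinal `δ` and indexing the ultrapower. -/
abbrev Idx (δ : Cardinal.{0}) : Type 1 := {o : Ordinal.{0} // o < δ.ord}

/-- A filter `F` is `κ`-complete (equivalently, `<κ`-closed): it is closed under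
intersections of fewer than `κ` of its members. -/
def IsCComplete (κ : Cardinal.{0}) {X : Type*} (F : Filter X) : Prop :=
  ∀ (ι : Type) (t : ι → Set X), #ι < κ → (∀ j, t j ∈ F) → (⋂ j, t j) ∈ F

/-- `U` is a normal ultrafilter on the measurable cardinal `δ`: `δ` is uncountable and
`U` is a `δ`-complete nonprincipal ultrafilter on `δ` such that every function that is
regressive on a set in `U` is constant on a set in `U`. -/
structure IsNormalUltrafilter (δ : Cardinal.{0}) (U : Ultrafilter (Idx δ)) : Prop where
  uncountable : ℵ₀ < δ
  complete : IsCComplete δ (U : Filter (Idx δ))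
  nonprincipal : ∀ i : Idx δ, ({i} : Set (Idx δ)) ∉ U
  normal : ∀ f : Idx δ → Ordinal.{0}, { i : Idx δ | f i < i.1 } ∈ U →
    ∃ c : Ordinal.{0}, { i : Idx δ | f i = c } ∈ U

variable {δ : Cardinal.{0}} {U : Ultrafilter (Idx δ)}

/-- The Łoś ordering on representatives of ordinals of the ultrapower `Ult(V,U)`. -/
def ultLT (U : Ultrafilter (Idx δ)) (f g : Idx δ → Ordinal.{0}) : Prop :=
  { i : Idx δ | f i < g i } ∈ U

theorem ultLT_wf (hU : IsNormalUltrafilter δ U) : WellFounded (ultLT U) := by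
  haveI : IsIrrefl (Idx δ → Ordinal.{0}) (ultLT U) := by
    constructor
    intro f hf
    have h : ({ i : Idx δ | f i < f i } : Set (Idx δ)) = ∅ := by ext i; simp
    rw [ultLT, h] at hf
    exact Filter.empty_notMem (U : Filter (Idx δ)) hf
  haveI : IsTrans (Idx δ → Ordinal.{0}) (ultLT U) := by
    constructor
    intro f g h hfg hgh
    have hsub : ({ i : Idx δ | f i < g i } ∩ { i : Idx δ | g i < h i } : Set (Idx δ)) ⊆
        { i : Idx δ | f i < h i } := fun i hi => show f i < h i from lt_trans hi.1 hi.2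
    exact Filter.mem_of_superset (Filter.inter_mem hfg hgh) hsub
  haveI : IsStrictOrder (Idx δ → Ordinal.{0}) (ultLT U) := ⟨⟩
  rw [RelEmbedding.wellFounded_iff_isEmpty]
  constructor
  intro g
  have hmem : ∀ n : ℕ, { i : Idx δ | g (n + 1) i < g n i } ∈ U :=
    fun n => g.map_rel_iff.2 (Nat.lt_succ_self n)
  have hint : (⋂ n : ℕ, { i : Idx δ | g (n + 1) i < g n i }) ∈ U := by
    refine hU.complete ℕ _ ?_ hmem
    rw [Cardinal.mk_nat]
    exact hU.uncountable
  obtain ⟨i, hi⟩ := Ultrafilter.nonempty_of_mem hint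
  have hdesc : ∀ n : ℕ, (fun n => g n i) (n + 1) < (fun n => g n i) n :=
    fun n => Set.mem_iInter.1 hi n
  exact (RelEmbedding.wellFounded_iff_isEmpty.1 Ordinal.lt_wf).false
    (RelEmbedding.natGT (fun n => g n i) hdesc)

/-- The ordinal represented by `f` in the transitive collapse of the ultrapower
`Ult(V,U)`, i.e. the rank of `f` in the (well-founded) Łoś ordering. -/
def ordRank (hU : IsNormalUltrafilter δ U) (f : Idx δ → Ordinal.{0}) : Ordinal.{0} :=
  sInf { o : Ordinal.{0} | Ordinal.lift.{1} o = ((ultLT_wf hU).apply f).rank }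

/-- The image of an ordinal under the ultrapower embedding `j_U : V → Ult(V,U)`. -/
def jU (hU : IsNormalUltrafilter δ U) (o : Ordinal.{0}) : Ordinal.{0} :=
  ordRank hU fun _ => o

/-- The set of ordinals that is the transitive collapse of the element of the
ultrapower `Ult(V,U)` represented by the function `f`. -/
def ultSet (hU : IsNormalUltrafilter δ U) (f : Idx δ → Set Ordinal.{0}) :
    Set Ordinal.{0} :=
  { o : Ordinal.{0} |
    ∃ g : Idx δ → Ordinal.{0}, { i : Idx δ | g i ∈ f i } ∈ U ∧ ordRank hU g = o }

/-- A set of ordinals is (the transitive collapse of) an element of the ultrapower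
`Ult(V,U)`. -/
def InUlt (hU : IsNormalUltrafilter δ U) (A : Set Ordinal.{0}) : Prop :=
  ∃ f : Idx δ → Set Ordinal.{0}, (∀ i, BddAbove (f i)) ∧ A = ultSet hU f

/-- The least upper bound of a set of ordinals. -/
def lub (A : Set Ordinal.{0}) : Ordinal.{0} :=
  sSup ((fun o => o + 1) '' A)

/-- Hamkins: a set `A` of ordinals is fresh over `Ult(V,U)` if `A ∉ Ult(V,U)` but
`A ∩ α ∈ Ult(V,U)` for every `α < lub A`. -/
def Fresh (hU : IsNormalUltrafilter δ U) (A : Set Ordinal.{0}) : Prop :=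
  ¬ InUlt hU A ∧ ∀ α < lub A, InUlt hU (A ∩ Iio α)

/-- `A` is an unbounded subset of the ordinal `l`. -/
def UnbSub (A : Set Ordinal.{0}) (l : Ordinal.{0}) : Prop :=
  A ⊆ Iio l ∧ ∀ b < l, ∃ a ∈ A, b ≤ a

/-- `A` is a closed subset of the ordinal `l`: it contains the suprema of all of its
nonempty subsets that are bounded below `l`. -/
def ClosedIn (A : Set Ordinal.{0}) (l : Ordinal.{0}) : Prop :=
  ∀ S ⊆ A, S.Nonempty → sSup S < l → sSup S ∈ A

/-- The set of limit points of a set of ordinals. -/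
def limitPts (A : Set Ordinal.{0}) : Set Ordinal.{0} :=
  { b : Ordinal.{0} | (A ∩ Iio b).Nonempty ∧ sSup (A ∩ Iio b) = b }

/-- `S` is a stationary subset of the ordinal `l`. -/
def StationaryIn (S : Set Ordinal.{0}) (l : Ordinal.{0}) : Prop :=
  S ⊆ Iio l ∧ ∀ D : Set Ordinal.{0}, ClosedIn D l → UnbSub D l → (S ∩ D).Nonempty

/-- The order type of the set of ordinals `C` is at most `o`. -/
def otpLE (C : Set Ordinal.{0}) (o : Ordinal.{0}) : Prop :=
  ∃ g : Ordinal.{0} → Ordinal.{0}, (∀ a ∈ C, g a < o) ∧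
    ∀ a ∈ C, ∀ b ∈ C, a < b → g a < g b

/-- The order type of the set of ordinals `C` is (strictly) less than `o`. -/
def otpLT (C : Set Ordinal.{0}) (o : Ordinal.{0}) : Prop :=
  ∃ o' < o, otpLE C o'

/-- `C` is a `□(Θ)`-sequence, where `Θ` is (the initial ordinal of) an uncountable
regular cardinal. -/
structure IsSquareSeq (Θ : Ordinal.{0}) (C : Ordinal.{0} → Set Ordinal.{0}) : Prop where
  closed : ∀ γ < Θ, Order.IsSuccLimit γ → ClosedIn (C γ) γ
  unbounded : ∀ γ < Θ, Order.IsSuccLimit γ → UnbSub (C γ) γ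
  coherent : ∀ γ < Θ, Order.IsSuccLimit γ → ∀ β ∈ limitPts (C γ), β < γ → C β = C γ ∩ Iio β
  nontrivial : ¬ ∃ D : Set Ordinal.{0}, ClosedIn D Θ ∧ UnbSub D Θ ∧
    ∀ γ ∈ limitPts D, γ < Θ → D ∩ Iio γ = C γ

/-- `C` is a `□_κ`-sequence: a `□(κ⁺)`-sequence all of whose clubs have order type
at most `κ`. -/
def IsSquareKappaSeq (κ : Cardinal.{0}) (C : Ordinal.{0} → Set Ordinal.{0}) : Prop :=
  IsSquareSeq (Order.succ κ).ord C ∧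
    ∀ γ < (Order.succ κ).ord, Order.IsSuccLimit γ → otpLE (C γ) κ.ord

/-- `κ` is a weakly compact cardinal: `κ` is uncountable and every coloring of the
pairs of ordinals below `κ` in fewer than `κ` colors has a homogeneous set of size `κ`. -/
def IsWeaklyCompact (κ : Cardinal.{0}) : Prop :=
  ℵ₀ < κ ∧ ∀ (ν : Type) (c : Ordinal.{0} → Ordinal.{0} → ν), #ν < κ →
    ∃ H : Set Ordinal.{0}, H ⊆ Iio κ.ord ∧ Cardinal.lift.{1} κ ≤ #H ∧
      ∀ a ∈ H, ∀ b ∈ H, ∀ a' ∈ H, ∀ b' ∈ H, a < b → a' < b' → c a b = c a' b'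

/-- `κ` is a strongly compact cardinal: every `κ`-complete filter (on any set)
extends to a `κ`-complete ultrafilter. -/
def IsStronglyCompact (κ : Cardinal.{0}) : Prop :=
  ∀ (X : Type) (F : Filter X), IsCComplete κ F →
    ∃ G : Ultrafilter X, F ≤ (G : Filter X) ∧ IsCComplete κ (G : Filter X)

/-- `κ` is a singular cardinal. -/
def IsSingular (κ : Cardinal.{0}) : Prop :=
  ℵ₀ ≤ κ ∧ κ.ord.cof < κ

/-- The cofinality of the ordinal `l` as computed inside the ultrapower `Ult(V,U)`
(as an ordinal, i.e. the image of the ultrapower's cofinality under the transitive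
collapse). -/
def cofUlt (hU : IsNormalUltrafilter δ U) (l : Ordinal.{0}) : Ordinal.{0} :=
  sInf { c : Ordinal.{0} | ∃ f : Idx δ → Ordinal.{0},
    ordRank hU f = l ∧ ordRank hU (fun i => ((f i).cof).ord) = c }

/-- The ordinal `o` is (the transitive collapse of) a cardinal of the ultrapower
`Ult(V,U)`. -/
def CardInUlt (hU : IsNormalUltrafilter δ U) (o : Ordinal.{0}) : Prop :=
  ∃ f : Idx δ → Ordinal.{0}, ordRank hU f = o ∧
    { i : Idx δ | ((f i).card).ord = f i } ∈ U

/-- The ordinal `o` is (the transitive collapse of) a regular cardinal of the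
ultrapower `Ult(V,U)`. -/
def RegularInUlt (hU : IsNormalUltrafilter δ U) (o : Ordinal.{0}) : Prop :=
  ∃ f : Idx δ → Ordinal.{0}, ordRank hU f = o ∧
    { i : Idx δ | ((f i).card).IsRegular ∧ ((f i).card).ord = f i } ∈ U

/-- The cardinal successor of the ordinal `o` as computed inside the ultrapower
`Ult(V,U)`: the least ordinal above `o` that is a cardinal in `Ult(V,U)`. -/
def succInUlt (hU : IsNormalUltrafilter δ U) (o : Ordinal.{0}) : Ordinal.{0} :=
  sInf { c : Ordinal.{0} | o < c ∧ CardInUlt hU c }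

/-- The cardinality of a set of ordinals, as an (initial) ordinal: the least ordinal
`o` such that `s` is the image of a function defined on the ordinals below `o`. -/
def setCardOrd (s : Set Ordinal.{0}) : Ordinal.{0} :=
  sInf { o : Ordinal.{0} | ∃ g : Ordinal.{0} → Ordinal.{0}, s ⊆ g '' Iio o }

theorem exists_lift_eq_rank (hU : IsNormalUltrafilter δ U) (f : Idx δ → Ordinal.{0}) :
    ∃ o : Ordinal.{0}, Ordinal.lift.{1} o = ((ultLT_wf hU).apply f).rank := by
  induction f using (ultLT_wf hU).induction with
  | _ f ih =>
  choose! r hr using ih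
  have : Small.{0} (Idx δ) := Ordinal.small_Iio _
  let S : Set (Idx δ → Ordinal.{0}) := { g | (∀ i, g i ≤ f i) ∧ ultLT U g f }
  have : Small.{0} S := by
    let e : S → (∀ i : Idx δ, Iic (f i)) := fun g i => ⟨g.1 i, g.2.1 i⟩
    refine small_of_injective (f := e) fun g h hgh => ?_
    ext i
    exact congrArg Subtype.val (congrFun hgh i)
  obtain ⟨b, hb⟩ : BddAbove (r '' S) := Ordinal.bddAbove_of_small
  have hle : ((ultLT_wf hU).apply f).rank ≤ Ordinal.lift.{1} (b + 1) := by
    rw [Acc.rank_eq]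
    refine Ordinal.iSup_le ?_
    rintro ⟨g, hg⟩
    let g' : Idx δ → Ordinal.{0} := fun i => min (g i) (f i)
    have hgg' : {i | g' i = g i} ∈ U := by
      filter_upwards [hg] with i hi
      exact min_eq_left (le_of_lt hi)
    have hg' : g' ∈ S := by
      refine ⟨fun i => min_le_right _ _, ?_⟩
      filter_upwards [hg, hgg'] with i hi h'
      rw [h']; exact hi
    have hrank : ((ultLT_wf hU).apply g).rank = ((ultLT_wf hU).apply g').rank := by
      rw [Acc.rank_eq, Acc.rank_eq]
      have hiff : ∀ h, ultLT U h g ↔ ultLT U h g' := fun h => by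
        constructor <;> intro hh <;> filter_upwards [hh, hgg'] with i hi h'
        · rw [h']; exact hi
        · rw [← h']; exact hi
      apply le_antisymm
      · refine Ordinal.iSup_le fun h => ?_
        exact Ordinal.le_iSup (fun b : {b // ultLT U b g'} =>
          Order.succ (((ultLT_wf hU).apply b.1).rank)) ⟨h.1, (hiff _).1 h.2⟩
      · refine Ordinal.iSup_le fun h => ?_
        exact Ordinal.le_iSup (fun b : {b // ultLT U b g} =>
          Order.succ (((ultLT_wf hU).apply b.1).rank)) ⟨h.1, (hiff _).2 h.2⟩
    change Order.succ (((ultLT_wf hU).apply g).rank) ≤ _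
    rw [hrank, ← hr g' hg'.2, Order.succ_le_iff, Ordinal.lift_lt]
    exact Order.lt_succ_iff.2 (hb ⟨g', hg', rfl⟩)
  exact Ordinal.mem_range_lift_of_le hle

theorem lift_ordRank (hU : IsNormalUltrafilter δ U) (f : Idx δ → Ordinal.{0}) :
    Ordinal.lift.{1} (ordRank hU f) = ((ultLT_wf hU).apply f).rank :=
  csInf_mem (s := { o : Ordinal.{0} | Ordinal.lift.{1} o = ((ultLT_wf hU).apply f).rank })
    (exists_lift_eq_rank hU f)

theorem ordRank_lt_of_ultLT (hU : IsNormalUltrafilter δ U) {f g : Idx δ → Ordinal.{0}}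
    (h : ultLT U f g) : ordRank hU f < ordRank hU g := by
  rw [← Ordinal.lift_lt.{1}, lift_ordRank, lift_ordRank]
  exact Acc.rank_lt_of_rel _ h

theorem ordRank_le_of_eventually_le (hU : IsNormalUltrafilter δ U) {f g : Idx δ → Ordinal.{0}}
    (h : {i | f i ≤ g i} ∈ U) : ordRank hU f ≤ ordRank hU g := by
  rw [← Ordinal.lift_le.{1}, lift_ordRank, lift_ordRank, Acc.rank_eq, Acc.rank_eq]
  refine Ordinal.iSup_le fun k => ?_
  refine Ordinal.le_iSup (fun b : {b // ultLT U b g} =>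
    Order.succ (((ultLT_wf hU).apply b.1).rank)) ⟨k.1, ?_⟩
  filter_upwards [h, k.2] with i hi hk
  exact lt_of_lt_of_le hk hi

theorem ordRank_lt_iff (hU : IsNormalUltrafilter δ U) {f g : Idx δ → Ordinal.{0}} :
    ordRank hU f < ordRank hU g ↔ {i | f i < g i} ∈ U := by
  refine ⟨fun h => ?_, ordRank_lt_of_ultLT hU⟩
  by_contra hn
  rw [← Ultrafilter.compl_mem_iff_notMem] at hn
  refine absurd h (not_lt.2 (ordRank_le_of_eventually_le hU ?_))
  filter_upwards [hn] with i hi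
  exact not_lt.1 hi

theorem ordRank_eq_iff (hU : IsNormalUltrafilter δ U) {f g : Idx δ → Ordinal.{0}} :
    ordRank hU f = ordRank hU g ↔ {i | f i = g i} ∈ U := by
  constructor
  · intro h
    have h₁ := mt (ordRank_lt_iff hU).2 h.not_lt
    have h₂ := mt (ordRank_lt_iff hU).2 h.not_gt
    rw [← Ultrafilter.compl_mem_iff_notMem] at h₁ h₂
    filter_upwards [h₁, h₂] with i hi hi'
    exact le_antisymm (not_lt.1 hi') (not_lt.1 hi)
  · intro h
    apply le_antisymm <;> apply ordRank_le_of_eventually_le <;> filter_upwards [h] with i hi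
    · exact le_of_eq hi
    · exact ge_of_eq hi

theorem exists_ordRank_eq_of_lt (hU : IsNormalUltrafilter δ U) {f : Idx δ → Ordinal.{0}}
    {o : Ordinal.{0}} (h : o < ordRank hU f) : ∃ g, ordRank hU g = o := by
  rw [← Ordinal.lift_lt.{1}, lift_ordRank] at h
  obtain ⟨g, hg, hgo⟩ := Acc.mem_range_rank_of_le _ h.le
  refine ⟨g, ?_⟩
  rw [← Ordinal.lift_inj.{1, 0}, lift_ordRank, ← hgo]

theorem ordRank_mem_ultSet_iff (hU : IsNormalUltrafilter δ U) {f : Idx δ → Set Ordinal.{0}}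
    {g : Idx δ → Ordinal.{0}} : ordRank hU g ∈ ultSet hU f ↔ {i | g i ∈ f i} ∈ U := by
  constructor
  · rintro ⟨g', hg', he⟩
    filter_upwards [hg', (ordRank_eq_iff hU).1 he] with i hi he
    rw [← he]; exact hi
  · exact fun h => ⟨g, h, rfl⟩

theorem exists_transfinite_construction {X : Type*} [Nonempty X]
    (Good : Ordinal.{0} → (Ordinal.{0} → X) → X → Prop)
    (congr : ∀ β T T' x, (∀ γ < β, T γ = T' γ) → Good β T x → Good β T' x)
    (ex : ∀ β T, (∀ γ < β, Good γ T (T γ)) → ∃ x, Good β T x) :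
    ∃ T : Ordinal.{0} → X, ∀ β, Good β T (T β) := by
  classical
  let ext (β : Ordinal.{0}) (ih : ∀ γ : Ordinal.{0}, γ < β → X) : Ordinal.{0} → X :=
    fun γ => if h : γ < β then ih γ h else Classical.arbitrary X
  let F (β : Ordinal.{0}) (ih : ∀ γ : Ordinal.{0}, γ < β → X) : X :=
    Classical.epsilon (Good β (ext β ih))
  let T : Ordinal.{0} → X := WellFounded.fix Ordinal.lt_wf F
  have hT : ∀ β, T β = Classical.epsilon (Good β (ext β fun γ _ => T γ)) := fun β =>
    WellFounded.fix_eq _ _ _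
  have hext : ∀ β, ∀ γ < β, ext β (fun γ _ => T γ) γ = T γ := fun β γ h => dif_pos h
  refine ⟨T, fun β => ?_⟩
  induction β using Ordinal.lt_wf.induction with
  | _ β ih =>
  obtain ⟨x, hx⟩ := ex β T ih
  refine congr β (ext β fun γ _ => T γ) T _ (hext β) ?_
  rw [hT β]
  exact Classical.epsilon_spec (p := Good β (ext β fun γ _ => T γ))
    ⟨x, congr _ _ _ _ (fun γ h => (hext β γ h).symm) hx⟩

theorem isSuccLimit_of_mem_limitPts {A : Set Ordinal.{0}} {b : Ordinal.{0}}
    (h : b ∈ limitPts A) : Order.IsSuccLimit b := by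
  obtain ⟨⟨a, haA, hab⟩, hs⟩ := h
  refine ⟨fun hb => not_isMin_of_lt hab hb, fun c hc => ?_⟩
  have hle : sSup (A ∩ Iio b) ≤ c := csSup_le ⟨a, haA, hab⟩ fun x hx => by
    exact hc.le_of_lt hx.2
  rw [hs] at hle
  exact absurd hle (not_le.2 hc.lt)

theorem mem_of_mem_limitPts {A : Set Ordinal.{0}} {b l : Ordinal.{0}} (hA : ClosedIn A l)
    (hb : b ∈ limitPts A) (hbl : b < l) : b ∈ A := by
  have := hA (A ∩ Iio b) inter_subset_left hb.1 (by rwa [hb.2])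
  rwa [hb.2] at this

theorem mem_limitPts_inter_Iio {A : Set Ordinal.{0}} {b l : Ordinal.{0}}
    (hb : b ∈ limitPts A) (hbl : b < l) : b ∈ limitPts (A ∩ Iio l) := by
  have : A ∩ Iio l ∩ Iio b = A ∩ Iio b := by
    rw [inter_assoc, Iio_inter_Iio, min_eq_right hbl.le]
  exact ⟨this ▸ hb.1, this ▸ hb.2⟩

theorem mk_le_of_forall_mk_inter_Iio_lt {S : Set Ordinal.{0}} {μ : Cardinal.{1}}
    (h : ∀ a ∈ S, #(S ∩ Iio a : Set Ordinal.{0}) < μ) : #S ≤ μ := by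
  by_contra! hlt
  have hlt' : μ.ord < Ordinal.type (α := S) (· < ·) :=
    (Cardinal.ord_lt_ord.2 hlt).trans_le (Cardinal.ord_le_type _)
  let a : S := Ordinal.enum (α := S) (· < ·) ⟨μ.ord, hlt'⟩
  have ha : #{y : S // y < a} = μ := by
    rw [← Ordinal.card_typein (r := ((· < ·) : S → S → Prop)), Ordinal.typein_enum, card_ord]
  refine (h a.1 a.2).not_ge ?_
  rw [← ha]
  exact Cardinal.mk_le_of_injective
    (f := fun y : {y : S // y < a} => (⟨y.1.1, y.1.2, y.2⟩ : (S ∩ Iio a.1 : Set Ordinal.{0})))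
    fun y z hyz => Subtype.ext (Subtype.ext (congrArg (fun w => w.1) hyz))

theorem mk_lt_of_mem_limitPts {κ : Cardinal.{0}} {C : Ordinal.{0} → Set Ordinal.{0}}
    (hC : IsSquareKappaSeq κ C) {β γ : Ordinal.{0}} (hβ : β < (Order.succ κ).ord)
    (hlim : Order.IsSuccLimit β) (hγ : γ ∈ limitPts (C β)) (hγβ : γ < β) :
    #(C γ) < Cardinal.lift.{1} κ := by
  obtain ⟨g, hg, hmono⟩ := hC.2 β hβ hlim
  have hmem := mem_of_mem_limitPts (hC.1.closed β hβ hlim) hγ hγβ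
  rw [hC.1.coherent β hβ hlim γ hγ hγβ]
  have hle : #(C β ∩ Iio γ : Set Ordinal.{0}) ≤ #(Iio (g γ)) := by
    refine Cardinal.mk_le_of_injective
      (f := fun a => (⟨g a.1, hmono _ a.2.1 _ hmem a.2.2⟩ : Iio (g γ))) fun a b hab => ?_
    have hab' : g a.1 = g b.1 := congrArg Subtype.val hab
    rcases lt_trichotomy a.1 b.1 with h | h | h
    · exact absurd hab' (hmono _ a.2.1 _ b.2.1 h).ne
    · exact Subtype.ext h
    · exact absurd hab' (hmono _ b.2.1 _ a.2.1 h).ne'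
  refine hle.trans_lt ?_
  rw [Cardinal.mk_Iio_ordinal, Cardinal.lift_lt]
  exact Cardinal.lt_ord.1 (hg γ hmem)

theorem mk_setOf_limitPts_le {κ : Cardinal.{0}} {C : Ordinal.{0} → Set Ordinal.{0}}
    (hC : IsSquareKappaSeq κ C) {β : Ordinal.{0}} (hβ : β < (Order.succ κ).ord)
    (hlim : Order.IsSuccLimit β) (μ : Cardinal.{1}) :
    #{γ | γ ∈ limitPts (C β) ∧ γ < β ∧ #(C γ) < μ} ≤ μ := by
  refine mk_le_of_forall_mk_inter_Iio_lt fun γ ⟨hγ, hγβ, hlt⟩ => ?_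
  refine (Cardinal.mk_le_mk_of_subset ?_).trans_lt hlt
  rw [hC.1.coherent β hβ hlim γ hγ hγβ]
  rintro α ⟨⟨hα, hαβ, -⟩, hαγ⟩
  exact ⟨mem_of_mem_limitPts (hC.1.closed β hβ hlim) hα hαβ, hαγ⟩

theorem sSup_limitPts_mem {A : Set Ordinal.{0}} {l : Ordinal.{0}} (hA : ClosedIn A l)
    (hne : (limitPts A ∩ Iio l).Nonempty) :
    sSup (limitPts A ∩ Iio l) ∈ limitPts A := by
  set s := sSup (limitPts A ∩ Iio l) with hs
  have hbdd : BddAbove (limitPts A ∩ Iio l) := ⟨l, fun x hx => hx.2.le⟩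
  by_cases hmem : s ∈ limitPts A
  · exact hmem
  have hsub : limitPts A ∩ Iio l ⊆ A ∩ Iio s := fun x hx =>
    ⟨mem_of_mem_limitPts hA hx.1 hx.2,
      lt_of_le_of_ne (le_csSup hbdd hx) fun h => hmem (by rw [hs, ← h]; exact hx.1)⟩
  refine ⟨hne.mono hsub, le_antisymm (csSup_le (hne.mono hsub) fun x hx => hx.2.le) ?_⟩
  exact csSup_le_csSup ⟨s, fun x hx => hx.2.le⟩ hne hsub

theorem exists_cofinal_nat_sequence {A : Set Ordinal.{0}} {l a : Ordinal.{0}}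
    (hunb : UnbSub A l) (hlim : Order.IsSuccLimit l) (hal : a < l)
    (ha : ∀ b ∈ limitPts A, b < l → b ≤ a) {d : Ordinal.{0}} (hd : d < l) :
    ∃ b : ℕ → Ordinal.{0}, d < b 0 ∧ (∀ n, b n < b (n + 1)) ∧ (∀ n, b n < l) ∧
      ∀ c < l, ∃ n, c < b n := by
  have hex : ∀ c, ∃ e, c < l → e ∈ A ∧ c < e := fun c => by
    by_cases hc : c < l
    · obtain ⟨e, he, hce⟩ := hunb.2 (Order.succ c) (hlim.succ_lt hc)
      exact ⟨e, fun _ => ⟨he, Order.succ_le_iff.1 hce⟩⟩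
    · exact ⟨0, fun h => absurd h hc⟩
  choose f hf using hex
  let b : ℕ → Ordinal.{0} := fun n => f^[n + 1] (max a d)
  have hb_succ : ∀ n, b (n + 1) = f (b n) := fun n => Function.iterate_succ_apply' f (n + 1) _
  have hb0 := hf (max a d) (max_lt hal hd)
  have hbA : ∀ n, b n ∈ A := fun n => by
    induction n with
    | zero => exact hb0.1
    | succ n ih => rw [hb_succ]; exact (hf _ (hunb.1 ih)).1
  have hblt : ∀ n, b n < b (n + 1) := fun n => by
    rw [hb_succ]; exact (hf _ (hunb.1 (hbA n))).2
  refine ⟨b, (le_max_right a d).trans_lt hb0.2, hblt, fun n => hunb.1 (hbA n), fun c hc => ?_⟩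
  by_contra! hle
  have hbdd : BddAbove (range b) := ⟨c, by rintro _ ⟨n, rfl⟩; exact hle n⟩
  have hsc : sSup (range b) ≤ c := csSup_le (range_nonempty b) (by rintro _ ⟨n, rfl⟩; exact hle n)
  have hlt : ∀ n, b n < sSup (range b) := fun n => (hblt n).trans_le (le_csSup hbdd ⟨n + 1, rfl⟩)
  have hsub : range b ⊆ A ∩ Iio (sSup (range b)) := by
    rintro _ ⟨n, rfl⟩
    exact ⟨hbA n, hlt n⟩
  have hmem : sSup (range b) ∈ limitPts A :=
    ⟨(range_nonempty b).mono hsub, le_antisymm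
      (csSup_le ((range_nonempty b).mono hsub) fun x hx => hx.2.le)
      (csSup_le_csSup ⟨_, fun x hx => hx.2.le⟩ (range_nonempty b) hsub)⟩
  exact (ha _ hmem (hsc.trans_lt hc)).not_gt (((le_max_left a d).trans_lt hb0.2).trans (hlt 0))

theorem exists_coherent_sequence (hU : IsNormalUltrafilter δ U) {κ : Cardinal.{0}}
    {C : Ordinal.{0} → Set Ordinal.{0}} (hC : IsSquareKappaSeq κ C)
    (k : Idx δ → Cardinal.{0}) (hk₀ : ∀ i, ℵ₀ ≤ k i) (hk : ∀ μ < κ, {i | μ < k i} ∈ U)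
    (P : Idx δ → Type 1) [∀ i, Preorder (P i)]
    (hP : ∀ i (S : Set (P i)), IsChain (· ≤ ·) S → #S ≤ Cardinal.lift.{1} (k i) → BddAbove S)
    (step : Ordinal.{0} → (∀ i, P i) → ∀ i, P i) (hstep : ∀ γ x i, x i ≤ step γ x i) :
    ∃ T : Ordinal.{0} → ∀ i, P i,
      (∀ β < (Order.succ κ).ord, ∀ γ < β, {i | T γ i ≤ T β i} ∈ U) ∧
      ∀ γ, γ + 1 < (Order.succ κ).ord → T (γ + 1) = step γ (T γ) := by
  classical
  have hne : ∀ i, Nonempty (P i) := fun i =>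
    ⟨(hP i ∅ IsChain.empty (by simp)).choose⟩
  let Good (β : Ordinal.{0}) (T : Ordinal.{0} → ∀ i, P i) (x : ∀ i, P i) : Prop :=
    β < (Order.succ κ).ord → (∀ γ < β, {i | T γ i ≤ x i} ∈ U) ∧
      (Order.IsSuccLimit β → ∀ γ ∈ limitPts (C β), γ < β →
        ∀ i, #(C γ) < Cardinal.lift.{1} (k i) → T γ i ≤ x i) ∧
      ∀ γ < β, β = γ + 1 → x = step γ (T γ)
  obtain ⟨T, hT⟩ : ∃ T : Ordinal.{0} → ∀ i, P i, ∀ β, Good β T (T β) := by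
    refine exists_transfinite_construction Good ?_ ?_
    · intro β T T' x hTT' hx hβ
      obtain ⟨h₁, h₂, h₃⟩ := hx hβ
      refine ⟨fun γ hγ => hTT' γ hγ ▸ h₁ γ hγ, fun hl γ hγ hγβ => hTT' γ hγβ ▸ h₂ hl γ hγ hγβ,
        fun γ hγ hs => hTT' γ hγ ▸ h₃ γ hγ hs⟩
    · intro β T ih
      by_cases hβ : β < (Order.succ κ).ord
      swap
      · exact ⟨fun i => Classical.arbitrary _, fun h => absurd h hβ⟩
      cases β using Ordinal.limitRecOn with
      | zero =>
        exact ⟨fun i => Classical.arbitrary _, fun _ => ⟨fun γ hγ => absurd hγ not_lt_zero,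
          fun hl => absurd hl.ne_bot (not_not.2 rfl), fun γ hγ => absurd hγ not_lt_zero⟩⟩
      | add_one α =>
        refine ⟨step α (T α), fun _ => ⟨fun γ hγ => ?_, fun hl => ?_, fun γ hγ hs => ?_⟩⟩
        · rcases (Order.lt_add_one_iff.1 hγ).eq_or_lt with rfl | hlt
          · exact Filter.univ_mem' fun i => hstep _ _ i
          · have hα : α < α + 1 := Order.lt_add_one_iff.2 le_rfl
            filter_upwards [(ih α hα (hα.trans hβ)).1 γ hlt] with i hi
            exact hi.trans (hstep _ _ i)
        · exact absurd hl (Order.not_isSuccLimit_add_one α)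
        · obtain rfl : α = γ := by simpa using hs
          rfl
      | limit β hlim =>
        have hlink : ∀ γ < β, ∀ α < γ, {i | T α i ≤ T γ i} ∈ U := fun γ hγ α hα =>
          (ih γ hγ (hγ.trans hβ)).1 α hα
        have hstrong : ∀ γ ∈ limitPts (C β), γ < β → ∀ α ∈ limitPts (C β), α < γ →
            ∀ i, #(C α) < Cardinal.lift.{1} (k i) → T α i ≤ T γ i := fun γ hγ hγβ α hα hαγ =>
          (ih γ hγβ (hγβ.trans hβ)).2.1 (isSuccLimit_of_mem_limitPts hγ) α
            (by rw [hC.1.coherent β hβ hlim γ hγ hγβ]; exact mem_limitPts_inter_Iio hα hαγ) hαγ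
        suffices h : ∃ x : ∀ i, P i, (∀ γ < β, {i | T γ i ≤ x i} ∈ U) ∧
            ∀ γ ∈ limitPts (C β), γ < β →
              ∀ i, #(C γ) < Cardinal.lift.{1} (k i) → T γ i ≤ x i by
          obtain ⟨x, h₁, h₂⟩ := h
          exact ⟨x, fun _ => ⟨h₁, fun _ => h₂, fun γ hγ hs =>
            absurd (hs ▸ hlim) (Order.not_isSuccLimit_add_one γ)⟩⟩
        by_cases hunb : ∀ α < β, ∃ γ ∈ limitPts (C β), γ < β ∧ α < γ
        · have hbdd : ∀ i, BddAbove ((fun γ => T γ i) ''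
              {γ | γ ∈ limitPts (C β) ∧ γ < β ∧ #(C γ) < Cardinal.lift.{1} (k i)}) := fun i => by
            refine hP i _ ?_ (Cardinal.mk_image_le.trans (mk_setOf_limitPts_le hC hβ hlim _))
            rintro _ ⟨γ, ⟨hγ, hγβ, hγi⟩, rfl⟩ _ ⟨γ', ⟨hγ', hγβ', hγi'⟩, rfl⟩ hneq
            rcases lt_trichotomy γ γ' with h | rfl | h
            · exact Or.inl (hstrong γ' hγ' hγβ' γ hγ h i hγi)
            · exact absurd rfl hneq
            · exact Or.inr (hstrong γ hγ hγβ γ' hγ' h i hγi')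
          choose x hx using hbdd
          have hx' : ∀ γ ∈ limitPts (C β), γ < β →
              ∀ i, #(C γ) < Cardinal.lift.{1} (k i) → T γ i ≤ x i := fun γ hγ hγβ i hi =>
            hx i ⟨γ, ⟨hγ, hγβ, hi⟩, rfl⟩
          refine ⟨x, fun α hα => ?_, hx'⟩
          obtain ⟨γ, hγ, hγβ, hαγ⟩ := hunb α hα
          obtain ⟨μ, hμκ, hμ⟩ := Cardinal.lt_lift_iff.1 (mk_lt_of_mem_limitPts hC hβ hlim hγ hγβ)
          filter_upwards [hlink γ hγβ α hαγ, hk μ hμκ] with i h₁ h₂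
          refine le_trans h₁ (hx' γ hγ hγβ i ?_)
          rw [← hμ, Cardinal.lift_lt]
          exact h₂
        · push Not at hunb
          obtain ⟨a, haβ, ha⟩ := hunb
          obtain ⟨w, d, hdβ, hwd, hw⟩ : ∃ (w : ∀ i, P i) (d : Ordinal.{0}), d < β ∧ w = T d ∧
              ∀ γ ∈ limitPts (C β), γ < β →
                ∀ i, #(C γ) < Cardinal.lift.{1} (k i) → T γ i ≤ w i := by
            by_cases hL : (limitPts (C β) ∩ Iio β).Nonempty
            · have hlt : sSup (limitPts (C β) ∩ Iio β) < β :=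
                (csSup_le hL fun x hx => ha x hx.1 hx.2).trans_lt haβ
              have hmem := sSup_limitPts_mem (hC.1.closed β hβ hlim) hL
              refine ⟨_, _, hlt, rfl, fun γ hγ hγβ i hi => ?_⟩
              have hle : γ ≤ sSup (limitPts (C β) ∩ Iio β) :=
                le_csSup ⟨β, fun x hx => hx.2.le⟩ ⟨hγ, hγβ⟩
              rcases hle.eq_or_lt with h | h
              · rw [← h]
              · exact hstrong _ hmem hlt γ hγ h i hi
            · exact ⟨_, a, haβ, rfl, fun γ hγ hγβ => absurd ⟨γ, hγ, hγβ⟩ hL⟩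
          obtain ⟨b, hdb, hblt, hbβ, hbc⟩ :=
            exists_cofinal_nat_sequence (hC.1.unbounded β hβ hlim) hlim haβ ha hdβ
          let X : Set (Idx δ) := {i | T d i ≤ T (b 0) i} ∩ ⋂ n, {i | T (b n) i ≤ T (b (n + 1)) i}
          have hX : X ∈ U := by
            refine Filter.inter_mem (hlink _ (hbβ 0) _ hdb) (hU.complete ℕ _ ?_ fun n =>
              hlink _ (hbβ _) _ (hblt n))
            rw [Cardinal.mk_nat]
            exact hU.uncountable
          have hmono : ∀ i ∈ X, Monotone fun n => T (b n) i := fun i hi =>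
            monotone_nat_of_le_succ fun n => Set.mem_iInter.1 hi.2 n
          have hbdd : ∀ i, ∃ y : P i, i ∈ X → ∀ n, T (b n) i ≤ y := fun i => by
            by_cases hi : i ∈ X
            · have hk' : ℵ₀ ≤ Cardinal.lift.{1} (k i) := by simpa using hk₀ i
              obtain ⟨y, hy⟩ := hP i (range fun n => T (b n) i) (hmono i hi).isChain_range
                ((Cardinal.le_aleph0_iff_set_countable.2 (countable_range _)).trans hk')
              exact ⟨y, fun _ n => hy ⟨n, rfl⟩⟩
            · exact ⟨Classical.arbitrary _, fun h => absurd h hi⟩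
          choose y hy using hbdd
          refine ⟨fun i => if i ∈ X then y i else w i, fun α hα => ?_, fun γ hγ hγβ i hi => ?_⟩
          · obtain ⟨n, hn⟩ := hbc α hα
            filter_upwards [hX, hlink _ (hbβ n) α hn] with i h₁ h₂
            rw [if_pos h₁]
            exact le_trans h₂ (hy i h₁ n)
          · refine (hw γ hγ hγβ i hi).trans ?_
            beta_reduce
            by_cases h : i ∈ X
            · rw [if_pos h, hwd]
              exact le_trans h.1 (hy i h 0)
            · rw [if_neg h]
  refine ⟨T, fun β hβ => (hT β hβ).1, fun γ hγ => (hT _ hγ).2.2 γ ?_ rfl⟩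
  exact Order.lt_add_one_iff.2 le_rfl

theorem setOf_ge_mem (hU : IsNormalUltrafilter δ U) (i₀ : Idx δ) : {i | i₀ ≤ i} ∈ U := by
  let t : i₀.1.ToType → Set (Idx δ) := fun j => {i | i.1 ≠ (Ordinal.ToType.mk.symm j).1}
  have ht : (⋂ j, t j) ∈ U := by
    refine hU.complete _ t ?_ fun j => ?_
    · rw [Cardinal.mk_toType]
      exact Cardinal.lt_ord.1 i₀.2
    · have hj : (Ordinal.ToType.mk.symm j).1 < δ.ord := (Ordinal.ToType.mk.symm j).2.trans i₀.2
      have := Ultrafilter.compl_mem_iff_notMem.2 (hU.nonprincipal ⟨_, hj⟩)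
      filter_upwards [this] with i hi h
      exact hi (Subtype.ext h)
  filter_upwards [ht] with i hi
  by_contra hlt
  refine Set.mem_iInter.1 hi (Ordinal.ToType.mk ⟨i.1, not_le.1 hlt⟩) ?_
  rw [OrderIso.symm_apply_apply]

theorem mk_Idx (δ : Cardinal.{0}) : #(Idx δ) = Cardinal.lift.{1} δ := by
  have := Cardinal.mk_Iio_ordinal δ.ord
  rwa [Cardinal.card_ord] at this

theorem exists_cofinal_cardinals (hU : IsNormalUltrafilter δ U) {κ : Cardinal.{0}}
    (hsl : κ.IsStrongLimit) (hcof : κ.ord.cof = δ) :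
    ∃ k : Idx δ → Cardinal.{0}, (∀ i, ℵ₀ ≤ k i) ∧ (∀ i, k i < κ) ∧
      ∀ μ < κ, {i | μ < k i} ∈ U := by
  have hδκ : δ ≤ κ := hcof ▸ Ordinal.cof_ord_le κ
  obtain ⟨s, hs, hmk⟩ := Order.exists_cof_eq (Iio κ.ord)
  rw [Ordinal.cof_Iio, ← Ordinal.lift_cof, hcof, ← mk_Idx] at hmk
  obtain ⟨e⟩ := Cardinal.eq.1 hmk.symm
  let S (i : Idx δ) : Set Ordinal.{0} := (fun j => (e j).1.1) '' Iic i
  have hSlt : ∀ i, sSup (S i) < κ.ord := fun i => by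
    refine Ordinal.sSup_lt_of_lt_cof ?_ ?_
    · rw [← Ordinal.lift_cof, hcof]
      have hi : i.1 + 1 < δ.ord :=
        (Cardinal.isSuccLimit_ord hU.uncountable.le).succ_lt i.2
      refine Cardinal.mk_image_le.trans_lt (lt_of_le_of_lt ?_
        (Cardinal.lift_lt.2 (Cardinal.lt_ord.1 hi)))
      rw [← Cardinal.mk_Iio_ordinal]
      exact Cardinal.mk_le_of_injective
        (f := fun j : Iic i =>
          (⟨j.1.1, Set.mem_Iio.2 (Order.lt_add_one_iff.2 j.2)⟩ : Iio (i.1 + 1)))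
        fun a b h => Subtype.ext (Subtype.ext (congrArg (fun w => w.1) h))
    · rintro _ ⟨j, -, rfl⟩
      exact (e j).1.2
  refine ⟨fun i => max ℵ₀ (sSup (S i)).card, fun i => le_max_left _ _, fun i =>
    max_lt (hU.uncountable.trans_le hδκ) (Cardinal.lt_ord.1 (hSlt i)), fun μ hμ => ?_⟩
  have hμ' : (Order.succ μ).ord < κ.ord := Cardinal.ord_lt_ord.2 (hsl.isSuccLimit.succ_lt hμ)
  obtain ⟨b, hbs, hb⟩ := hs ⟨_, hμ'⟩
  filter_upwards [setOf_ge_mem hU (e.symm ⟨b, hbs⟩)] with i hi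
  refine lt_max_of_lt_right (Order.succ_le_iff.1 (Cardinal.ord_le.1 ?_))
  refine le_trans hb (le_csSup ?_ ⟨e.symm ⟨b, hbs⟩, hi, by simp⟩)
  exact ⟨κ.ord, by rintro _ ⟨j, -, rfl⟩; exact (e j).1.2.le⟩

theorem exists_enumeration {κ : Cardinal.{0}} (hsl : κ.IsStrongLimit)
    (hsch : κ ^ δ = Order.succ κ) (m : Idx δ → Ordinal.{0}) (hm : ∀ i, m i < κ.ord) :
    ∃ F : Ordinal.{0} → Idx δ → Set Ordinal.{0}, ∀ f : Idx δ → Set Ordinal.{0},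
      (∀ i, f i ⊆ Iio (m i)) → ∃ γ < (Order.succ κ).ord, F γ = f := by
  let W : Type 1 := {f : Idx δ → Set Ordinal.{0} // ∀ i, f i ⊆ Iio (m i)}
  have hW : #W ≤ #(Iio (Order.succ κ).ord) := by
    calc #W ≤ #(∀ i, Set (Iio (m i))) := by
          refine Cardinal.mk_le_of_injective
            (f := fun (f : W) i => (Subtype.val ⁻¹' f.1 i : Set (Iio (m i)))) fun f g h => ?_
          refine Subtype.ext (funext fun i => ?_)
          have hi := congrArg (fun s => Subtype.val '' s) (congrFun h i)
          simpa [Subtype.image_preimage_coe, inter_eq_right.2 (f.2 i),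
            inter_eq_right.2 (g.2 i)] using hi
      _ ≤ Cardinal.prod fun _ : Idx δ => Cardinal.lift.{1} κ := by
          rw [Cardinal.mk_pi]
          refine Cardinal.prod_le_prod _ _ fun i => ?_
          rw [Cardinal.mk_set, Cardinal.mk_Iio_ordinal, ← Cardinal.lift_two_power,
            Cardinal.lift_le]
          exact (hsl.isStrongPrelimit (Cardinal.lt_ord.1 (hm i))).le
      _ = #(Iio (Order.succ κ).ord) := by
          rw [Cardinal.prod_const', mk_Idx, ← Cardinal.lift_power, hsch,
            Cardinal.mk_Iio_ordinal, Cardinal.card_ord]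
  obtain ⟨e⟩ := hW
  have : Nonempty W := ⟨⟨fun _ => ∅, fun _ => empty_subset _⟩⟩
  classical
  refine ⟨fun γ => if h : γ ∈ Iio (Order.succ κ).ord then (Function.invFun e ⟨γ, h⟩).1
    else fun _ => ∅, fun f hf => ⟨(e ⟨f, hf⟩).1, (e ⟨f, hf⟩).2, ?_⟩⟩
  exact (dif_pos (e ⟨f, hf⟩).2).trans
    (congrArg Subtype.val (Function.leftInverse_invFun e.injective ⟨f, hf⟩))

/-- A set of ordinals together with an upper bound below `m`, thought of as a binary
sequence of length less than `m`. -/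
structure BoundedString (m : Ordinal.{0}) : Type 1 where
  /-- The length of the binary sequence. -/
  len : Ordinal.{0}
  /-- The set of positions carrying a one. -/
  carrier : Set Ordinal.{0}
  len_lt : len < m
  subset : carrier ⊆ Iio len

/-- Binary sequences are ordered by end-extension. -/
instance (m : Ordinal.{0}) : Preorder (BoundedString m) where
  le p q := p.len ≤ q.len ∧ q.carrier ∩ Iio p.len = p.carrier
  le_refl p := ⟨le_rfl, inter_eq_left.2 p.subset⟩
  le_trans p q r hpq hqr := by
    refine ⟨hpq.1.trans hqr.1, ?_⟩
    rw [← hpq.2, ← hqr.2, inter_assoc, Iio_inter_Iio, min_eq_right hpq.1]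

theorem BoundedString.bddAbove_of_isChain {μ : Cardinal.{0}} (hμ : ℵ₀ ≤ μ)
    {S : Set (BoundedString (Order.succ μ).ord)} (hS : IsChain (· ≤ ·) S)
    (hmk : #S ≤ Cardinal.lift.{1} μ) : BddAbove S := by
  have hbdd : BddAbove (BoundedString.len '' S) :=
    ⟨(Order.succ μ).ord, by rintro _ ⟨p, -, rfl⟩; exact p.len_lt.le⟩
  refine ⟨⟨sSup (BoundedString.len '' S), ⋃ p ∈ S, p.carrier, ?_, ?_⟩, fun p hp => ⟨?_, ?_⟩⟩
  · refine Ordinal.sSup_lt_of_lt_cof ?_ (by rintro _ ⟨p, -, rfl⟩; exact p.len_lt)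
    rw [← Ordinal.lift_cof, (Cardinal.isRegular_succ hμ).cof_ord]
    exact (Cardinal.mk_image_le.trans hmk).trans_lt (Cardinal.lift_lt.2 (Order.lt_succ μ))
  · refine Set.iUnion₂_subset fun p hp a ha => ?_
    exact lt_of_lt_of_le (p.subset ha) (le_csSup hbdd ⟨p, hp, rfl⟩)
  · exact le_csSup hbdd ⟨p, hp, rfl⟩
  · refine Subset.antisymm ?_ fun a ha => ⟨Set.mem_biUnion hp ha, p.subset ha⟩
    rintro a ⟨ha, hap⟩
    obtain ⟨q, hq, haq⟩ := Set.mem_iUnion₂.1 ha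
    rcases hS.total hp hq with h | h
    · exact h.2 ▸ ⟨haq, hap⟩
    · exact (h.2.symm ▸ haq : a ∈ p.carrier ∩ Iio q.len).1

/-- Extend a bounded string by two positions: the first carries a one, and the second
carries a one exactly when it does not belong to `s`. -/
def BoundedString.extend {m : Ordinal.{0}} (hm : Order.IsSuccLimit m) (p : BoundedString m)
    (s : Set Ordinal.{0}) : BoundedString m where
  len := p.len + 1 + 1
  carrier := p.carrier ∪ ({p.len} ∪ ({p.len + 1} \ s))
  len_lt := hm.succ_lt (hm.succ_lt p.len_lt)
  subset := by
    have h₁ : p.len < p.len + 1 := Order.lt_succ _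
    have h₂ : p.len + 1 < p.len + 1 + 1 := Order.lt_succ _
    refine Set.union_subset (fun a ha => (p.subset ha).trans (h₁.trans h₂)) ?_
    rintro a (rfl | ⟨rfl, -⟩)
    exacts [h₁.trans h₂, h₂]

theorem BoundedString.le_extend {m : Ordinal.{0}} (hm : Order.IsSuccLimit m)
    (p : BoundedString m) (s : Set Ordinal.{0}) : p ≤ p.extend hm s := by
  have h₁ : p.len < p.len + 1 := Order.lt_succ _
  have h₂ : p.len + 1 < p.len + 1 + 1 := Order.lt_succ _
  refine ⟨(h₁.trans h₂).le, Subset.antisymm ?_ fun a ha => ⟨Or.inl ha, p.subset ha⟩⟩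
  rintro a ⟨ha | rfl | ⟨rfl, -⟩, hap⟩
  · exact ha
  · exact absurd (mem_Iio.1 hap) (lt_irrefl _)
  · exact absurd hap h₁.not_gt

theorem BoundedString.len_mem_extend {m : Ordinal.{0}} (hm : Order.IsSuccLimit m)
    (p : BoundedString m) (s : Set Ordinal.{0}) : p.len ∈ (p.extend hm s).carrier :=
  Or.inr (Or.inl rfl)

theorem BoundedString.len_add_one_mem_extend_iff {m : Ordinal.{0}} (hm : Order.IsSuccLimit m)
    (p : BoundedString m) (s : Set Ordinal.{0}) :
    p.len + 1 ∈ (p.extend hm s).carrier ↔ p.len + 1 ∉ s := by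
  have h₁ : p.len < p.len + 1 := Order.lt_succ _
  refine ⟨?_, fun h => Or.inr (Or.inr ⟨rfl, h⟩)⟩
  rintro (h | h | ⟨-, h⟩)
  · exact absurd (p.subset h) h₁.not_gt
  · exact absurd h h₁.ne'
  · exact h

theorem exists_diagonalizing_sequence (hU : IsNormalUltrafilter δ U) {κ : Cardinal.{0}}
    (hsl : κ.IsStrongLimit) (hcof : κ.ord.cof = δ) (hsch : κ ^ δ = Order.succ κ)
    {C : Ordinal.{0} → Set Ordinal.{0}} (hC : IsSquareKappaSeq κ C) :
    ∃ (m : Idx δ → Ordinal.{0}) (hm : ∀ i, Order.IsSuccLimit (m i))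
      (T : Ordinal.{0} → ∀ i, BoundedString (m i)),
      (∀ β < (Order.succ κ).ord, ∀ γ ≤ β, {i | T γ i ≤ T β i} ∈ U) ∧
      (∀ γ < (Order.succ κ).ord, ∃ f : Idx δ → Set Ordinal.{0},
        ∀ i, T (γ + 1) i = (T γ i).extend (hm i) (f i)) ∧
      ∀ f : Idx δ → Set Ordinal.{0}, ∃ γ < (Order.succ κ).ord,
        ∀ i, T (γ + 1) i = (T γ i).extend (hm i) (f i ∩ Iio (m i)) := by
  obtain ⟨k, hk₀, hkκ, hk⟩ := exists_cofinal_cardinals hU hsl hcof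
  have hm (i : Idx δ) : Order.IsSuccLimit (Order.succ (k i)).ord :=
    Cardinal.isSuccLimit_ord ((hk₀ i).trans (Order.le_succ _))
  obtain ⟨F, hF⟩ := exists_enumeration hsl hsch (fun i => (Order.succ (k i)).ord)
    fun i => Cardinal.ord_lt_ord.2 (hsl.isSuccLimit.succ_lt (hkκ i))
  obtain ⟨T, hT, hstep⟩ := exists_coherent_sequence hU hC k hk₀ hk
    (fun i => BoundedString (Order.succ (k i)).ord)
    (fun i S hS hmk => BoundedString.bddAbove_of_isChain (hk₀ i) hS hmk)
    (fun γ x i => (x i).extend (hm i) (F γ i)) fun γ x i => (x i).le_extend (hm i) _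
  have hΘ : Order.IsSuccLimit (Order.succ κ).ord :=
    Cardinal.isSuccLimit_ord (hsl.aleph0_le.trans (Order.le_succ _))
  refine ⟨_, hm, T, fun β hβ γ hγ => ?_, fun γ hγ => ⟨F γ, fun i => ?_⟩, fun f => ?_⟩
  · rcases hγ.eq_or_lt with rfl | hγ
    · exact Filter.mem_of_superset Filter.univ_mem fun i _ => le_refl (T γ i)
    · exact hT β hβ γ hγ
  · rw [hstep γ (hΘ.succ_lt hγ)]
  · obtain ⟨γ, hγ, hFγ⟩ := hF (fun i => f i ∩ Iio _) fun i => inter_subset_right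
    exact ⟨γ, hγ, fun i => by rw [hstep γ (hΘ.succ_lt hγ), hFγ]⟩

/-- An end-extending sequence of elements of the ultrapower that diagonalizes against every
element of the ultrapower has a fresh union. -/
theorem exists_fresh_of_diagonalizing (hU : IsNormalUltrafilter δ U) {Θ : Ordinal.{0}}
    (hΘ : Order.IsSuccLimit Θ) {m : Idx δ → Ordinal.{0}} (hm : ∀ i, Order.IsSuccLimit (m i))
    {T : Ordinal.{0} → ∀ i, BoundedString (m i)}
    (hT : ∀ β < Θ, ∀ γ ≤ β, {i | T γ i ≤ T β i} ∈ U)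
    (hext : ∀ γ < Θ, ∃ f : Idx δ → Set Ordinal.{0},
      ∀ i, T (γ + 1) i = (T γ i).extend (hm i) (f i))
    (hdiag : ∀ f : Idx δ → Set Ordinal.{0}, ∃ γ < Θ,
      ∀ i, T (γ + 1) i = (T γ i).extend (hm i) (f i ∩ Iio (m i))) :
    ∃ l : Ordinal.{0}, l.cof = Θ.cof ∧ ∃ A : Set Ordinal.{0}, UnbSub A l ∧ Fresh hU A := by
  let L (γ : Ordinal.{0}) : Ordinal.{0} := ordRank hU fun i => (T γ i).len
  let A : Set Ordinal.{0} := {o | ∃ γ < Θ, o ∈ ultSet hU fun i => (T γ i).carrier}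
  have hstep (γ : Ordinal.{0}) (hγ : γ < Θ) : L γ < L (γ + 1) := by
    obtain ⟨f, hf⟩ := hext γ hγ
    refine (ordRank_lt_iff hU).2 (Filter.mem_of_superset Filter.univ_mem fun i _ => ?_)
    change (T γ i).len < (T (γ + 1) i).len
    rw [hf i]
    exact (Order.lt_succ _).trans (Order.lt_succ _)
  have hL (γ β : Ordinal.{0}) (hβ : β < Θ) (h : γ < β) : L γ < L β := by
    refine (hstep γ (h.trans hβ)).trans_le (ordRank_le_of_eventually_le hU ?_)
    filter_upwards [hT β hβ (γ + 1) (Order.succ_le_of_lt h)] with i hi using hi.1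
  have hmono : StrictMono fun γ : Iio Θ => L γ := fun γ β h => hL γ β β.2 h
  have hbdd : BddAbove (range fun γ : Iio Θ => L γ) := Ordinal.bddAbove_of_small
  have hLl (γ : Ordinal.{0}) (hγ : γ < Θ) : L γ < ⨆ γ : Iio Θ, L γ :=
    (hstep γ hγ).trans_le (le_ciSup hbdd ⟨γ + 1, hΘ.succ_lt hγ⟩)
  have hlt {o : Ordinal.{0}} (ho : o < ⨆ γ : Iio Θ, L γ) : ∃ γ < Θ, o < L γ := by
    have : Nonempty (Iio Θ) := ⟨⟨0, hΘ.bot_lt⟩⟩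
    obtain ⟨γ, hγ⟩ := exists_lt_of_lt_ciSup ho
    exact ⟨γ, γ.2, hγ⟩
  have hA {g : Idx δ → Ordinal.{0}} {γ : Ordinal.{0}} (hγ : γ < Θ) (hg : ordRank hU g < L γ) :
      ordRank hU g ∈ A ↔ {i | g i ∈ (T γ i).carrier} ∈ U := by
    refine ⟨?_, fun h => ⟨γ, hγ, (ordRank_mem_ultSet_iff hU).2 h⟩⟩
    rintro ⟨β, hβ, h⟩
    rw [ordRank_mem_ultSet_iff] at h
    rcases le_total β γ with hle | hle
    · filter_upwards [h, hT γ hγ β hle] with i hi hTi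
      exact (hTi.2.symm ▸ hi : g i ∈ (T γ i).carrier ∩ Iio (T β i).len).1
    · filter_upwards [h, hT β hβ γ hle, (ordRank_lt_iff hU).1 hg] with i hi hTi hgi
      exact hTi.2 ▸ ⟨hi, hgi⟩
  have hAL : A ⊆ Iio (⨆ γ : Iio Θ, L γ) := by
    rintro _ ⟨γ, hγ, g, hg, rfl⟩
    refine lt_trans ((ordRank_lt_iff hU).2 ?_) (hLl γ hγ)
    filter_upwards [hg] with i hi using (T γ i).subset hi
  refine ⟨⨆ γ : Iio Θ, L γ, Ordinal.cof_iSup_Iio hmono hΘ.isSuccPrelimit, A,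
    ⟨hAL, fun b hb => ?_⟩, ?_, fun α hα => ?_⟩
  · obtain ⟨γ, hγ, hbγ⟩ := hlt hb
    obtain ⟨f, hf⟩ := hext γ hγ
    refine ⟨L γ, (hA (hΘ.succ_lt hγ) (hstep γ hγ)).2 ?_, hbγ.le⟩
    refine Filter.mem_of_superset Filter.univ_mem fun i _ => ?_
    change (T γ i).len ∈ (T (γ + 1) i).carrier
    rw [hf i]
    exact BoundedString.len_mem_extend _ _ _
  · rintro ⟨f, -, hf⟩
    obtain ⟨γ, hγ, hγf⟩ := hdiag f
    have hlen : ordRank hU (fun i => (T γ i).len + 1) < L (γ + 1) := by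
      refine (ordRank_lt_iff hU).2 (Filter.mem_of_superset Filter.univ_mem fun i _ => ?_)
      change (T γ i).len + 1 < (T (γ + 1) i).len
      rw [hγf i]
      exact Order.lt_succ _
    have h := hA (hΘ.succ_lt hγ) hlen
    have hset : {i | (T γ i).len + 1 ∈ (T (γ + 1) i).carrier} =
        {i | (T γ i).len + 1 ∈ f i}ᶜ := by
      ext i
      have hlt : (T γ i).len + 1 ∈ Iio (m i) := (hm i).succ_lt (T γ i).len_lt
      rw [mem_compl_iff, mem_ofPred_eq, mem_ofPred_eq, hγf i,
        BoundedString.len_add_one_mem_extend_iff, mem_inter_iff, and_iff_left hlt]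
    rw [hf, ordRank_mem_ultSet_iff, Order.succ_eq_add_one, hset,
      Ultrafilter.compl_mem_iff_notMem] at h
    exact iff_not_self h
  · have hαl : α < ⨆ γ : Iio Θ, L γ := hα.trans_le <| csSup_le' <| by
      rintro _ ⟨o, ho, rfl⟩
      exact Order.succ_le_of_lt (hAL ho)
    obtain ⟨γ, hγ, hαγ⟩ := hlt hαl
    obtain ⟨h, rfl⟩ := exists_ordRank_eq_of_lt hU hαγ
    refine ⟨fun i => (T γ i).carrier ∩ Iio (h i), fun i => ⟨h i, fun a ha => ha.2.le⟩, ?_⟩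
    ext o
    constructor
    · rintro ⟨ho, hoh⟩
      obtain ⟨g, rfl⟩ := exists_ordRank_eq_of_lt hU hoh
      rw [ordRank_mem_ultSet_iff]
      exact Filter.inter_mem ((hA hγ (lt_trans hoh hαγ)).1 ho) ((ordRank_lt_iff hU).1 hoh)
    · rintro ⟨g, hg, rfl⟩
      have hgh : ordRank hU g < ordRank hU h := by
        refine (ordRank_lt_iff hU).2 ?_
        filter_upwards [hg] with i hi using hi.2
      refine ⟨(hA hγ (hgh.trans hαγ)).2 ?_, hgh⟩
      filter_upwards [hg] with i hi using hi.1

/-- If there is a singular strong limit cardinal `κ` of cofinality `δ` with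
`κ^δ = κ⁺` (the SCH at `κ`) carrying a `□_κ`-sequence, then there is a limit ordinal
`λ` with `cof(λ) = κ⁺` together with an unbounded subset of `λ` that is fresh over
`Ult(V,U)`. -/
theorem stmt10 (δ : Cardinal.{0}) (U : Ultrafilter (Idx δ)) (hU : IsNormalUltrafilter δ U)
    (κ : Cardinal.{0}) (hsing : IsSingular κ) (hsl : κ.IsStrongLimit)
    (hcof : κ.ord.cof = δ) (hsch : κ ^ δ = Order.succ κ)
    (hsq : ∃ C : Ordinal.{0} → Set Ordinal.{0}, IsSquareKappaSeq κ C) :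
    ∃ l : Ordinal.{0}, Order.IsSuccLimit l ∧ l.cof = Order.succ κ ∧
      ∃ A : Set Ordinal.{0}, UnbSub A l ∧ Fresh hU A := by
  obtain ⟨C, hC⟩ := hsq
  obtain ⟨m, hm, T, hT, hext, hdiag⟩ := exists_diagonalizing_sequence hU hsl hcof hsch hC
  have hreg : (Order.succ κ).IsRegular := Cardinal.isRegular_succ hsing.1
  obtain ⟨l, hl, A, hA, hfresh⟩ := exists_fresh_of_diagonalizing hU
    (Cardinal.isSuccLimit_ord hreg.aleph0_le) hm hT hext hdiag
  rw [hreg.cof_ord] at hl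
  exact ⟨l, Ordinal.one_lt_cof_iff.1 (hl ▸ Cardinal.one_lt_aleph0.trans_le hreg.aleph0_le), hl,
    A, hA, hfresh⟩

end MU
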